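/- Let m ≥ 1 and N ≥ 2 be integers and let p be a real number with 1 < p ≤ N − 1. Suppose f_1,…,f_m satisfy (C1)–(C2), b_1,…,b_m : [0,∞) → [0,∞) are continuous, and β > 0. Define sequences of functions on [0,∞) by w_i^0 ≡ β for i = 1,…,m and, for k ≥ 1, w_i^k(r) = β + ∫_0^r ( t^{1−N} ∫_0^t s^{N−1} b_i(s) f_i(w_1^{k−1}(s),…,w_m^{k−1}(s)) ds )^{1/(p−1)} dt. Then for every i and k: w_i^k is well defined and continuous on [0,∞), w_i^k is nondecreasing in r, w_i^k(r) ≥ β for all r ≥ 0, and w_i^k(r) ≤ w_i^{k+1}(r) for all r ≥ 0 (the sequence is nondecreasing in k). -/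

import Mathlib

open Real MeasureTheory Filter Set intervalIntegral

/-- `F(s) = ∫_0^s Σ_{i=1}^m f_i(t,…,t) dt`. -/
noncomputable def Fsum (m : ℕ) (f : Fin m → (Fin m → ℝ) → ℝ) (s : ℝ) : ℝ :=
  ∫ t in (0:ℝ)..s, ∑ i, f i (fun _ => t)

/-- Conditions (C1)–(C2): each `f j` maps `[0,∞)^m` to `[0,∞)`, is continuously
differentiable in each variable, vanishes at the origin, is positive when all
arguments are positive, and is nondecreasing in each variable. -/
def SatC12 (m : ℕ) (f : Fin m → (Fin m → ℝ) → ℝ) : Prop :=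
  (∀ j (i : Fin m) (s : Fin m → ℝ), (∀ l, 0 ≤ s l) →
    ContDiffOn ℝ 1 (fun t => f j (Function.update s i t)) (Set.Ici 0)) ∧
  (∀ j s, (∀ l, 0 ≤ s l) → 0 ≤ f j s) ∧
  (∀ j, f j (fun _ => 0) = 0) ∧
  (∀ j s, (∀ l, 0 < s l) → 0 < f j s) ∧
  (∀ j s t, (∀ l, 0 ≤ s l) → (∀ l, s l ≤ t l) → f j s ≤ f j t)

/-- Condition (C3): `∫_1^∞ F(s)^(-1/p) ds = ∞`. -/
def SatC3 (m : ℕ) (p : ℝ) (f : Fin m → (Fin m → ℝ) → ℝ) : Prop :=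
  Tendsto (fun r => ∫ s in (1:ℝ)..r, (Fsum m f s) ^ (-1/p)) atTop atTop

/-- A radial solution of the system with coefficients `b` and initial value `β`:
`w i r = β + ∫_0^r (t^(1-N) ∫_0^t s^(N-1) b i s · f i (w₁(s),…,w_m(s)) ds)^(1/(p-1)) dt`. -/
def IsRadialSolution (m N : ℕ) (p : ℝ) (b : Fin m → ℝ → ℝ)
    (f : Fin m → (Fin m → ℝ) → ℝ) (β : ℝ) (w : Fin m → ℝ → ℝ) : Prop :=
  (∀ i, ContinuousOn (w i) (Set.Ici 0)) ∧
  (∀ i r, 0 ≤ r → 0 ≤ w i r) ∧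
  (∀ i r, 0 ≤ r → w i r = β + ∫ t in (0:ℝ)..r,
      (t ^ (1 - (N:ℝ)) * ∫ s in (0:ℝ)..t,
        s ^ ((N:ℝ) - 1) * b i s * f i (fun j => w j s)) ^ (1/(p-1)))

/-- The successive approximations `w_i^0 ≡ β`,
`w_i^(k+1)(r) = β + ∫_0^r (t^(1-N) ∫_0^t s^(N-1) b_i(s) f_i(w^k(s)) ds)^(1/(p-1)) dt`. -/
noncomputable def approx (m N : ℕ) (p : ℝ) (b : Fin m → ℝ → ℝ)
    (f : Fin m → (Fin m → ℝ) → ℝ) (β : ℝ) : ℕ → Fin m → ℝ → ℝ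
  | 0 => fun _ _ => β
  | (k+1) => fun i r => β + ∫ t in (0:ℝ)..r,
      (t ^ (1 - (N:ℝ)) * ∫ s in (0:ℝ)..t,
        s ^ ((N:ℝ) - 1) * b i s * f i (fun j => approx m N p b f β k j s)) ^ (1/(p-1))

/-- inner integrand -/
noncomputable def hIn (N : ℕ) (c g : ℝ → ℝ) (s : ℝ) : ℝ := s ^ ((N:ℝ) - 1) * c s * g s

/-- outer integrand -/
noncomputable def gOut (N : ℕ) (p : ℝ) (c g : ℝ → ℝ) (t : ℝ) : ℝ :=
  (t ^ (1 - (N:ℝ)) * ∫ s in (0:ℝ)..t, hIn N c g s) ^ (1/(p-1))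

theorem hIn_nonneg {N : ℕ} {c g : ℝ → ℝ} (hc0 : ∀ r, 0 ≤ r → 0 ≤ c r)
    (hg0 : ∀ r, 0 ≤ r → 0 ≤ g r) (s : ℝ) (hs : 0 ≤ s) : 0 ≤ hIn N c g s :=
  mul_nonneg (mul_nonneg (Real.rpow_nonneg hs _) (hc0 s hs)) (hg0 s hs)

theorem hIn_int {N : ℕ} (hN : 2 ≤ N) {c g : ℝ → ℝ} (hc : ContinuousOn c (Set.Ici 0))
    (hg : MonotoneOn g (Set.Ici 0)) (t : ℝ) (ht : 0 ≤ t) :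
    IntervalIntegrable (hIn N c g) volume 0 t := by
  have hN' : (2:ℝ) ≤ N := by exact_mod_cast hN
  have hsub : Set.uIcc 0 t ⊆ Set.Ici (0:ℝ) := by
    rw [Set.uIcc_of_le ht]; exact Set.Icc_subset_Ici_self
  have h1 : IntervalIntegrable g volume 0 t := (hg.mono hsub).intervalIntegrable
  refine h1.continuousOn_mul (g := fun s => s ^ ((N:ℝ) - 1) * c s) ?_
  refine ContinuousOn.mul ?_ (hc.mono hsub)
  exact (Real.continuous_rpow_const (by linarith)).continuousOn

theorem hInt_nonneg {N : ℕ} {c g : ℝ → ℝ} (hc0 : ∀ r, 0 ≤ r → 0 ≤ c r)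
    (hg0 : ∀ r, 0 ≤ r → 0 ≤ g r) (t : ℝ) (ht : 0 ≤ t) :
    0 ≤ t ^ (1 - (N:ℝ)) * ∫ s in (0:ℝ)..t, hIn N c g s :=
  mul_nonneg (Real.rpow_nonneg ht _)
    (intervalIntegral.integral_nonneg ht fun s hs => hIn_nonneg hc0 hg0 s hs.1)

theorem gOut_nonneg {N : ℕ} {p : ℝ} {c g : ℝ → ℝ} (hc0 : ∀ r, 0 ≤ r → 0 ≤ c r)
    (hg0 : ∀ r, 0 ≤ r → 0 ≤ g r) (t : ℝ) (ht : 0 ≤ t) : 0 ≤ gOut N p c g t :=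
  Real.rpow_nonneg (hInt_nonneg hc0 hg0 t ht) _

theorem gOut_int {N : ℕ} {p : ℝ} (hN : 2 ≤ N) (hp : 1 < p) {c g : ℝ → ℝ}
    (hc : ContinuousOn c (Set.Ici 0)) (hc0 : ∀ r, 0 ≤ r → 0 ≤ c r)
    (hg : MonotoneOn g (Set.Ici 0)) (hg0 : ∀ r, 0 ≤ r → 0 ≤ g r) (R : ℝ) (hR : 0 ≤ R) :
    IntervalIntegrable (gOut N p c g) volume 0 R := by
  have hN' : (2:ℝ) ≤ N := by exact_mod_cast hN
  have hq : 0 ≤ 1/(p-1) := by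
    have : 0 < p - 1 := by linarith
    positivity
  obtain ⟨C, hC⟩ := (isCompact_Icc (a := (0:ℝ)) (b := R)).bddAbove_image
    (hc.mono Set.Icc_subset_Ici_self)
  have hC' : ∀ s, 0 ≤ s → s ≤ R → c s ≤ C := fun s h0 h1 =>
    hC (Set.mem_image_of_mem _ ⟨h0, h1⟩)
  have hC0 : 0 ≤ C := (hc0 0 le_rfl).trans (hC' 0 le_rfl hR)
  have hgR : 0 ≤ g R := hg0 R hR
  have hcont : ContinuousOn (gOut N p c g) (Set.Ioc 0 R) := by
    have hH : ContinuousOn (fun t => ∫ s in (0:ℝ)..t, hIn N c g s) (Set.Ioc 0 R) := by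
      have := intervalIntegral.continuousOn_primitive_interval'
        (hIn_int hN hc hg R hR) Set.left_mem_uIcc
      refine this.mono ?_
      rw [Set.uIcc_of_le hR]; exact Set.Ioc_subset_Icc_self
    refine ContinuousOn.rpow_const (ContinuousOn.mul ?_ hH) (fun _ _ => Or.inr hq)
    exact ContinuousOn.rpow_const continuousOn_id (fun x hx => Or.inl hx.1.ne')
  rw [intervalIntegrable_iff_integrableOn_Ioc_of_le hR]
  refine IntegrableOn.of_bound (by simp)
    (hcont.aestronglyMeasurable measurableSet_Ioc) ((R * (C * g R)) ^ (1/(p-1))) ?_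
  refine (ae_restrict_iff' measurableSet_Ioc).2 (Eventually.of_forall fun t ht => ?_)
  rw [Real.norm_of_nonneg (gOut_nonneg hc0 hg0 t ht.1.le)]
  refine Real.rpow_le_rpow (hInt_nonneg hc0 hg0 t ht.1.le) ?_ hq
  have hH : ∫ s in (0:ℝ)..t, hIn N c g s ≤ ∫ s in (0:ℝ)..t, t ^ ((N:ℝ) - 1) * C * g R := by
    refine intervalIntegral.integral_mono_on ht.1.le (hIn_int hN hc hg t ht.1.le) (by simp) ?_
    intro s hs
    have hsR : s ≤ R := hs.2.trans ht.2
    have h1 : s ^ ((N:ℝ) - 1) ≤ t ^ ((N:ℝ) - 1) :=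
      Real.rpow_le_rpow hs.1 hs.2 (by linarith)
    have h2 : g s ≤ g R := hg hs.1 hR hsR
    have h3 := hC' s hs.1 hsR
    have h4 := hg0 s hs.1
    have h5 := hc0 s hs.1
    have h6 : 0 ≤ t ^ ((N:ℝ) - 1) := Real.rpow_nonneg ht.1.le _
    exact mul_le_mul (mul_le_mul h1 h3 h5 h6) h2 h4 (mul_nonneg h6 hC0)
  rw [intervalIntegral.integral_const, smul_eq_mul, sub_zero] at hH
  have h7 : t ^ (1 - (N:ℝ)) * t ^ ((N:ℝ) - 1) = 1 := by
    rw [← Real.rpow_add ht.1]; simp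
  calc t ^ (1 - (N:ℝ)) * ∫ s in (0:ℝ)..t, hIn N c g s
      ≤ t ^ (1 - (N:ℝ)) * (t * (t ^ ((N:ℝ) - 1) * C * g R)) :=
        mul_le_mul_of_nonneg_left hH (Real.rpow_nonneg ht.1.le _)
    _ = (t ^ (1 - (N:ℝ)) * t ^ ((N:ℝ) - 1)) * (t * (C * g R)) := by ring
    _ = t * (C * g R) := by rw [h7, one_mul]
    _ ≤ R * (C * g R) := mul_le_mul_of_nonneg_right ht.2 (mul_nonneg hC0 hgR)

theorem gOut_mono {N : ℕ} {p : ℝ} (hN : 2 ≤ N) (hp : 1 < p) {c g g' : ℝ → ℝ}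
    (hc : ContinuousOn c (Set.Ici 0)) (hc0 : ∀ r, 0 ≤ r → 0 ≤ c r)
    (hg : MonotoneOn g (Set.Ici 0)) (hg0 : ∀ r, 0 ≤ r → 0 ≤ g r)
    (hg' : MonotoneOn g' (Set.Ici 0)) (hgg : ∀ r, 0 ≤ r → g r ≤ g' r) (t : ℝ) (ht : 0 ≤ t) :
    gOut N p c g t ≤ gOut N p c g' t := by
  have hq : 0 ≤ 1/(p-1) := by
    have : 0 < p - 1 := by linarith
    positivity
  refine Real.rpow_le_rpow (hInt_nonneg hc0 hg0 t ht) ?_ hq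
  refine mul_le_mul_of_nonneg_left ?_ (Real.rpow_nonneg ht _)
  refine intervalIntegral.integral_mono_on ht (hIn_int hN hc hg t ht) (hIn_int hN hc hg' t ht) ?_
  intro s hs
  exact mul_le_mul_of_nonneg_left (hgg s hs.1)
    (mul_nonneg (Real.rpow_nonneg hs.1 _) (hc0 s hs.1))

theorem prim_props {G : ℝ → ℝ} (hG : ∀ R, 0 ≤ R → IntervalIntegrable G volume 0 R)
    (hG0 : ∀ t, 0 ≤ t → 0 ≤ G t) (β : ℝ) :
    ContinuousOn (fun r => β + ∫ t in (0:ℝ)..r, G t) (Set.Ici 0) ∧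
    MonotoneOn (fun r => β + ∫ t in (0:ℝ)..r, G t) (Set.Ici 0) ∧
    ∀ r, 0 ≤ r → β ≤ β + ∫ t in (0:ℝ)..r, G t := by
  refine ⟨continuousOn_const.add ?_, ?_, ?_⟩
  · intro r hr
    have hr' : (0:ℝ) ≤ r := hr
    have h := intervalIntegral.continuousOn_primitive_interval'
      (hG (r+1) (by linarith)) Set.left_mem_uIcc
    rw [Set.uIcc_of_le (by linarith)] at h
    refine (h r ⟨hr, by linarith⟩).mono_of_mem_nhdsWithin ?_
    have : Set.Ici (0:ℝ) ∩ Set.Iio (r+1) ∈ nhdsWithin r (Set.Ici 0) :=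
      inter_mem self_mem_nhdsWithin (mem_nhdsWithin_of_mem_nhds (Iio_mem_nhds (by linarith)))
    exact mem_of_superset this fun x hx => ⟨hx.1, le_of_lt hx.2⟩
  · intro x hx y hy hxy
    have hx' : (0:ℝ) ≤ x := hx
    have h := intervalIntegral.integral_interval_sub_left (hG y hy) (hG x hx)
    have h2 : 0 ≤ ∫ t in x..y, G t :=
      intervalIntegral.integral_nonneg hxy fun t ht => hG0 t (hx'.trans ht.1)
    show β + _ ≤ β + _
    linarith
  · intro r hr
    have := intervalIntegral.integral_nonneg hr (f := G) (μ := volume) fun t ht => hG0 t ht.1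
    linarith

/-- Basic properties of the successive approximations: continuity, monotonicity in `r`,
lower bound `β`, and monotonicity in `k`. -/
theorem stmt5 (m N : ℕ) (p : ℝ) (hm : 1 ≤ m) (hN : 2 ≤ N)
    (hp1 : 1 < p) (hpN : p ≤ (N:ℝ) - 1)
    (f : Fin m → (Fin m → ℝ) → ℝ) (hf12 : SatC12 m f)
    (b : Fin m → ℝ → ℝ) (hbc : ∀ j, ContinuousOn (b j) (Set.Ici 0))
    (hbnn : ∀ j r, 0 ≤ r → 0 ≤ b j r)
    (β : ℝ) (hβ : 0 < β) :
    ∀ (k : ℕ) (i : Fin m),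
      ContinuousOn (approx m N p b f β k i) (Set.Ici 0) ∧
      MonotoneOn (approx m N p b f β k i) (Set.Ici 0) ∧
      (∀ r, 0 ≤ r → β ≤ approx m N p b f β k i r) ∧
      (∀ r, 0 ≤ r → approx m N p b f β k i r ≤ approx m N p b f β (k+1) i r) := by
  obtain ⟨-, hfnn, -, -, hfm⟩ := hf12
  have hsucc : ∀ k i, approx m N p b f β (k+1) i = fun r => β + ∫ t in (0:ℝ)..r,
      gOut N p (b i) (fun s => f i (fun j => approx m N p b f β k j s)) t := by
    intro k i
    funext r
    rfl
  have hP : ∀ k i, ContinuousOn (approx m N p b f β k i) (Set.Ici 0) ∧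
      MonotoneOn (approx m N p b f β k i) (Set.Ici 0) ∧
      (∀ r, 0 ≤ r → β ≤ approx m N p b f β k i r) := by
    intro k
    induction k with
    | zero =>
      intro i
      exact ⟨continuousOn_const, monotoneOn_const, fun _ _ => le_rfl⟩
    | succ k ih =>
      intro i
      have h0 : ∀ r, 0 ≤ r → ∀ j, 0 ≤ approx m N p b f β k j r :=
        fun r hr j => hβ.le.trans ((ih j).2.2 r hr)
      have hg0 : ∀ r, 0 ≤ r → 0 ≤ f i (fun j => approx m N p b f β k j r) :=
        fun r hr => hfnn i _ (h0 r hr)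
      have hg : MonotoneOn (fun s => f i (fun j => approx m N p b f β k j s)) (Set.Ici 0) :=
        fun x hx y hy hxy => hfm i _ _ (h0 x hx) fun j => (ih j).2.1 hx hy hxy
      rw [hsucc]
      exact prim_props (gOut_int hN hp1 (hbc i) (hbnn i) hg hg0)
        (gOut_nonneg (hbnn i) hg0) β
  have hnn : ∀ k r, 0 ≤ r → ∀ j, 0 ≤ approx m N p b f β k j r :=
    fun k r hr j => hβ.le.trans ((hP k j).2.2 r hr)
  have hg0 : ∀ k i r, 0 ≤ r → 0 ≤ f i (fun j => approx m N p b f β k j r) :=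
    fun k i r hr => hfnn i _ (hnn k r hr)
  have hg : ∀ k i,
      MonotoneOn (fun s => f i (fun j => approx m N p b f β k j s)) (Set.Ici 0) :=
    fun k i x hx y hy hxy => hfm i _ _ (hnn k x hx) fun j => (hP k j).2.1 hx hy hxy
  have hQ : ∀ k i r, 0 ≤ r → approx m N p b f β k i r ≤ approx m N p b f β (k+1) i r := by
    intro k
    induction k with
    | zero => exact fun i r hr => (hP 1 i).2.2 r hr
    | succ k ih =>
      intro i r hr
      rw [hsucc (k+1), hsucc k]
      refine add_le_add le_rfl ?_
      refine intervalIntegral.integral_mono_on hr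
        (gOut_int hN hp1 (hbc i) (hbnn i) (hg k i) (hg0 k i) r hr)
        (gOut_int hN hp1 (hbc i) (hbnn i) (hg (k+1) i) (hg0 (k+1) i) r hr) ?_
      intro t ht
      exact gOut_mono hN hp1 (hbc i) (hbnn i) (hg k i) (hg0 k i) (hg (k+1) i)
        (fun s hs => hfm i _ _ (hnn k s hs) fun j => ih j s hs) t ht.1
  exact fun k i => ⟨(hP k i).1, (hP k i).2.1, (hP k i).2.2, hQ k i⟩
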